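/- arXiv:1501.06142 — 5 statements merged into one kernel-verified Lean document; each statement's English description precedes it below -/
import Mathlib

section
/- Let (S, ≼) be a preordered class. Suppose there is a sequence s_1 ≼ s_2 ≼ s_3 ≼ ⋯ of elements of S which has no upper bound in S (i.e., there is no t ∈ S with s_n ≼ t for all n) and which has the property that for all s ∈ S and all n ∈ ℕ, if s_n ≼ s then there exists t ∈ S with s ≼ t and s_{n+1} ≼ t. Then (S, ≼) admits no minimal complete set (i.e., has type 0). -/
/-- The set of minimal elements of a poset `X` lying below `x`. -/
def minBelow (X : Type*) [PartialOrder X] (x : X) : Set X :=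
  {m | m ≤ x ∧ ∀ z : X, z ≤ m → z = m}

/-- A p-morphism between posets: a monotone map commuting with `minBelow`. -/
def IsPMorphism {X Y : Type*} [PartialOrder X] [PartialOrder Y] (u : X → Y) : Prop :=
  Monotone u ∧ ∀ x : X, u '' minBelow X x = minBelow Y (u x)

/-- Condition `(*)`. -/
def StarCond (X : Type*) [PartialOrder X] : Prop :=
  ∀ x y : X, ∃ z : X, IsLUB {x, y} z ∧ minBelow X z = minBelow X x ∪ minBelow X y

/-- Condition `(*_n)` for `n ≥ 1`. -/
def StarCondN (n : ℕ) (X : Type*) [PartialOrder X] : Prop :=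
  ∀ x y : X, (minBelow X x ∪ minBelow X y).ncard ≤ n →
    ∃ z : X, IsLUB {x, y} z ∧ minBelow X z = minBelow X x ∪ minBelow X y

/-- Condition `(*_n)` with the convention that `(*_0)` means nonempty. -/
def StarCondN' (n : ℕ) (X : Type*) [PartialOrder X] : Prop :=
  if n = 0 then Nonempty X else StarCondN n X

/-- The poset `X` belongs to the class `P^f_n`. -/
def InPfn (n : ℕ) (X : Type*) [PartialOrder X] : Prop :=
  ∀ x : X, (minBelow X x).ncard ≤ n

/-- `M` is a complete set for the preordered class `(S, le)`. -/
def IsCompleteSet {S : Type*} (le : S → S → Prop) (M : Set S) : Prop :=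
  ∀ x : S, ∃ y ∈ M, le x y

/-- `M` is a minimal complete set for the preordered class `(S, le)`. -/
def IsMinimalCompleteSet {S : Type*} (le : S → S → Prop) (M : Set S) : Prop :=
  IsCompleteSet le M ∧ ∀ x ∈ M, ∀ y ∈ M, le x y → x = y

/-- A connected subset of a poset. -/
def IsConnectedSub (X : Type*) [PartialOrder X] (Y : Set X) : Prop :=
  (∀ y ∈ Y, minBelow X y ⊆ Y) ∧
  ∀ x ∈ Y, ∀ y ∈ Y, ∃ z ∈ Y, x ≤ z ∧ y ≤ z ∧
    minBelow X z = minBelow X x ∪ minBelow X y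

/-- An `n`-connected subset of a poset. -/
def IsNConnectedSub (n : ℕ) (X : Type*) [PartialOrder X] (Y : Set X) : Prop :=
  (∀ y ∈ Y, minBelow X y ⊆ Y) ∧
  (∀ S : Set X, S ⊆ (⋃ y ∈ Y, minBelow X y) → S.Nonempty → S.ncard ≤ n →
    ∃ z ∈ Y, minBelow X z = S) ∧
  (∀ x ∈ Y, ∀ y ∈ Y, minBelow X x = minBelow X y → (minBelow X x).ncard < n →
    ∃ (r : ℕ) (c : ℕ → X), c 0 = x ∧ c r = y ∧ (∀ i ≤ r, c i ∈ Y) ∧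
      (∀ i ≤ r, minBelow X (c i) = minBelow X x) ∧
      (∀ i < r, if Even i then c (i + 1) ≤ c i else c i ≤ c (i + 1)))

/-- The special product `X ⊙ Y`. -/
abbrev Odot (X Y : Type*) : Type _ :=
  {p : WithBot X × WithBot Y // p ≠ (⊥, ⊥)}

/-- The subposet `(X)_n` of elements with at most `n` minimal elements below them. -/
abbrev SubPn (n : ℕ) (X : Type*) [PartialOrder X] : Type _ :=
  {x : X // (minBelow X x).ncard ≤ n}

/-- A unifier for a finite poset `X`: a p-morphism into `X` from a nonempty finite
poset satisfying `(*)`. -/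
structure Unifier (X : Type) [PartialOrder X] [Finite X] : Type 1 where
  Y : Type
  [po : PartialOrder Y]
  [fin : Finite Y]
  ne : Nonempty Y
  star : StarCond Y
  u : Y → X
  hu : IsPMorphism u

attribute [instance] Unifier.po Unifier.fin

/-- The "more general" preorder on unifiers: `v ≼ w`. -/
def UnifierLE {X : Type} [PartialOrder X] [Finite X] (v w : Unifier X) : Prop :=
  ∃ ψ : v.Y → w.Y, IsPMorphism ψ ∧ w.u ∘ ψ = v.u

/-- An `n`-unifier for a finite poset `X` in `P^f_n`. -/
structure UnifierN (n : ℕ) (X : Type) [PartialOrder X] [Finite X] : Type 1 where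
  Y : Type
  [po : PartialOrder Y]
  [fin : Finite Y]
  ne : Nonempty Y
  mem : InPfn n Y
  star : StarCondN n Y
  u : Y → X
  hu : IsPMorphism u

attribute [instance] UnifierN.po UnifierN.fin

/-- The "more general" preorder on `n`-unifiers: `v ≼ w`. -/
def UnifierNLE {n : ℕ} {X : Type} [PartialOrder X] [Finite X] (v w : UnifierN n X) : Prop :=
  ∃ ψ : v.Y → w.Y, IsPMorphism ψ ∧ w.u ∘ ψ = v.u

/-- Theorem (Baader, condition (i)): an increasing sequence without upper bound such
that every element above `s n` has a common extension with `s (n+1)` forces type 0. -/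
theorem increasing_sequence_no_minimal_complete_set {S : Type*} [Preorder S] (s : ℕ → S)
    (hchain : ∀ n : ℕ, s n ≤ s (n + 1))
    (hnub : ¬ ∃ t : S, ∀ n : ℕ, s n ≤ t)
    (hext : ∀ (x : S) (n : ℕ), s n ≤ x → ∃ t : S, x ≤ t ∧ s (n + 1) ≤ t) :
    ¬ ∃ M : Set S, IsMinimalCompleteSet (· ≤ ·) M := by
  rintro ⟨M, hcomplete, hmin⟩
  obtain ⟨m, hm, h0⟩ := hcomplete (s 0)
  refine hnub ⟨m, fun n => ?_⟩
  induction n with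
  | zero => exact h0
  | succ n ih =>
    obtain ⟨t, hmt, hst⟩ := hext m n ih
    obtain ⟨y, hy, hty⟩ := hcomplete t
    have hmy : m = y := hmin m hm y hy (le_trans hmt hty)
    exact hmy ▸ le_trans hst hty
end

section
/- Let (S, ≼) be a preordered class that is directed (for all x, y ∈ S there exists z ∈ S with x ≼ z and y ≼ z). If there is a sequence s_1 ≼ s_2 ≼ s_3 ≼ ⋯ of elements of S which has no upper bound in S (no t ∈ S with s_n ≼ t for all n), then (S, ≼) admits no minimal complete set (i.e., has type 0). -/
/-- Theorem (Baader, condition (ii)): a directed preordered class containing an increasing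
sequence without upper bound has no minimal complete set (type 0). -/
theorem directed_unbounded_sequence_no_minimal_complete_set {S : Type*} [Preorder S]
    (hdir : ∀ x y : S, ∃ z : S, x ≤ z ∧ y ≤ z)
    (s : ℕ → S) (hchain : ∀ n : ℕ, s n ≤ s (n + 1))
    (hnub : ¬ ∃ t : S, ∀ n : ℕ, s n ≤ t) :
    ¬ ∃ M : Set S, IsMinimalCompleteSet (· ≤ ·) M := by
  rintro ⟨M, hcomplete, hmin⟩
  obtain ⟨m, hm, -⟩ := hcomplete (s 0)
  refine hnub ⟨m, fun n => ?_⟩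
  obtain ⟨z, hmz, hsz⟩ := hdir m (s n)
  obtain ⟨y, hy, hzy⟩ := hcomplete z
  obtain rfl : m = y := hmin m hm y hy (hmz.trans hzy)
  exact hsz.trans hzy
end

section
/- Let X and Y be finite posets. Then X ⊙ Y satisfies condition (*) if and only if both X and Y satisfy condition (*). -/
/-- The minimal elements of `X` lying below an element of `WithBot X`. -/
def minBelowBot {X : Type*} [PartialOrder X] (a : WithBot X) : Set X :=
  {m | (m : WithBot X) ≤ a ∧ ∀ z : X, z ≤ m → z = m}

@[simp] lemma minBelowBot_coe {X : Type*} [PartialOrder X] (x : X) :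
    minBelowBot (x : WithBot X) = minBelow X x := by
  simp [minBelowBot, minBelow]

@[simp] lemma minBelowBot_bot {X : Type*} [PartialOrder X] :
    minBelowBot (⊥ : WithBot X) = ∅ := by
  simp [minBelowBot]

lemma isLUB_pair_coe_iff {X : Type*} [PartialOrder X] {x y z : X} :
    IsLUB {(x : WithBot X), (y : WithBot X)} (z : WithBot X) ↔ IsLUB {x, y} z := by
  simp only [isLUB_iff_le_iff, upperBounds_insert, upperBounds_singleton, Set.mem_inter_iff,
    Set.mem_Ici]
  refine ⟨fun h b => by simpa using h b, fun h b => ?_⟩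
  cases b with
  | bot => simp
  | coe b => simpa using h b

lemma StarCond.exists_isLUB_withBot {X : Type*} [PartialOrder X] (h : StarCond X)
    (a b : WithBot X) :
    ∃ c, IsLUB {a, b} c ∧ minBelowBot c = minBelowBot a ∪ minBelowBot b := by
  cases a with
  | bot => exact ⟨b, by simp [isLUB_iff_le_iff, upperBounds_insert], by simp⟩
  | coe x =>
    cases b with
    | bot => exact ⟨x, by simp [isLUB_iff_le_iff, upperBounds_insert], by simp⟩
    | coe y =>
      obtain ⟨z, hz, hm⟩ := h x y
      exact ⟨z, isLUB_pair_coe_iff.2 hz, by simpa using hm⟩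

namespace Odot

variable {X Y : Type*}

/-- The element `(x, ⊥)` of `X ⊙ Y`. -/
def inl (x : X) : Odot X Y := ⟨(x, ⊥), by simp⟩

/-- The element `(⊥, y)` of `X ⊙ Y`. -/
def inr (y : Y) : Odot X Y := ⟨(⊥, y), by simp⟩

lemma inl_injective : Function.Injective (inl : X → Odot X Y) := fun x x' h => by
  simpa [inl] using h

lemma inr_injective : Function.Injective (inr : Y → Odot X Y) := fun y y' h => by
  simpa [inr] using h

variable [PartialOrder X] [PartialOrder Y]

lemma exists_inl_or_inr_le (p : Odot X Y) :
    (∃ x, inl x ≤ p) ∨ ∃ y, inr y ≤ p := by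
  obtain ⟨⟨a, b⟩, hp⟩ := p
  cases a with
  | coe x => exact .inl ⟨x, Subtype.mk_le_mk.2 ⟨le_rfl, bot_le⟩⟩
  | bot =>
    cases b with
    | coe y => exact .inr ⟨y, Subtype.mk_le_mk.2 ⟨le_rfl, le_rfl⟩⟩
    | bot => exact absurd rfl hp

lemma inl_le_iff {x : X} {p : Odot X Y} : inl x ≤ p ↔ (x : WithBot X) ≤ p.1.1 := by
  simp [inl, ← Subtype.coe_le_coe, Prod.le_def]

lemma inr_le_iff {y : Y} {p : Odot X Y} : inr y ≤ p ↔ (y : WithBot Y) ≤ p.1.2 := by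
  simp [inr, ← Subtype.coe_le_coe, Prod.le_def]

lemma inl_mem_minBelow_iff {x : X} {p : Odot X Y} :
    inl x ∈ minBelow (Odot X Y) p ↔ x ∈ minBelowBot p.1.1 := by
  refine and_congr inl_le_iff ⟨fun h z hz => ?_, fun h q hq => ?_⟩
  · exact inl_injective (h (inl z) (inl_le_iff.2 (WithBot.coe_le_coe.2 hz)))
  · obtain ⟨⟨a, b⟩, hp⟩ := q
    obtain ⟨ha, hb⟩ := Subtype.mk_le_mk.1 hq
    obtain rfl : b = ⊥ := le_bot_iff.1 hb
    cases a with
    | bot => exact absurd rfl hp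
    | coe z => simp [inl, h z (WithBot.coe_le_coe.1 ha)]

lemma inr_mem_minBelow_iff {y : Y} {p : Odot X Y} :
    inr y ∈ minBelow (Odot X Y) p ↔ y ∈ minBelowBot p.1.2 := by
  refine and_congr inr_le_iff ⟨fun h z hz => ?_, fun h q hq => ?_⟩
  · exact inr_injective (h (inr z) (inr_le_iff.2 (WithBot.coe_le_coe.2 hz)))
  · obtain ⟨⟨a, b⟩, hp⟩ := q
    obtain ⟨ha, hb⟩ := Subtype.mk_le_mk.1 hq
    obtain rfl : a = ⊥ := le_bot_iff.1 ha
    cases b with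
    | bot => exact absurd rfl hp
    | coe z => simp [inr, h z (WithBot.coe_le_coe.1 hb)]

lemma minBelow_eq_union_iff {p q r : Odot X Y} :
    minBelow (Odot X Y) r = minBelow (Odot X Y) p ∪ minBelow (Odot X Y) q ↔
      minBelowBot r.1.1 = minBelowBot p.1.1 ∪ minBelowBot q.1.1 ∧
        minBelowBot r.1.2 = minBelowBot p.1.2 ∪ minBelowBot q.1.2 := by
  simp only [Set.ext_iff, Set.mem_union, ← inl_mem_minBelow_iff, ← inr_mem_minBelow_iff]
  refine ⟨fun h => ⟨fun x => h (inl x), fun y => h (inr y)⟩, fun ⟨hl, hr⟩ m => ?_⟩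
  by_cases hm : ∀ z, z ≤ m → z = m
  · rcases exists_inl_or_inr_le m with ⟨x, hx⟩ | ⟨y, hy⟩
    · exact hm _ hx ▸ hl x
    · exact hm _ hy ▸ hr y
  · simp only [minBelow, Set.mem_ofPred_eq, hm, and_false, or_self]

lemma isLUB_pair_iff {p q r : Odot X Y} :
    IsLUB {p, q} r ↔ IsLUB {p.1.1, q.1.1} r.1.1 ∧ IsLUB {p.1.2, q.1.2} r.1.2 := by
  have key : IsLUB {p, q} r ↔ IsLUB {p.1, q.1} r.1 := by
    simp only [isLUB_iff_le_iff, upperBounds_insert, upperBounds_singleton, Set.mem_inter_iff,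
      Set.mem_Ici]
    refine ⟨fun h b => ?_, fun h b => h b.1⟩
    by_cases hb : b = (⊥, ⊥)
    · have hbot (s : Odot X Y) : ¬ s.1 ≤ b := fun hs =>
        s.2 (le_bot_iff.1 (hs.trans_eq hb))
      simp [hbot]
    · exact h ⟨b, hb⟩
  rw [key, isLUB_prod, Set.image_pair, Set.image_pair]

end Odot

/-- `X ⊙ Y` satisfies `(*)` iff both `X` and `Y` satisfy `(*)`. -/
theorem odot_starCond_iff (X Y : Type*) [PartialOrder X] [PartialOrder Y]
    [Finite X] [Finite Y] :
    StarCond (Odot X Y) ↔ StarCond X ∧ StarCond Y := by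
  constructor
  · refine fun h => ⟨fun x x' => ?_, fun y y' => ?_⟩
    · obtain ⟨r, hr, hm⟩ := h (Odot.inl x) (Odot.inl x')
      have hlub := (Odot.isLUB_pair_iff.1 hr).1
      have hmin := (Odot.minBelow_eq_union_iff.1 hm).1
      obtain ⟨z, hz, -⟩ := WithBot.coe_le_iff.1 (hlub.1 (Set.mem_insert _ _))
      rw [hz] at hlub hmin
      exact ⟨z, isLUB_pair_coe_iff.1 hlub, by simpa [Odot.inl] using hmin⟩
    · obtain ⟨r, hr, hm⟩ := h (Odot.inr y) (Odot.inr y')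
      have hlub := (Odot.isLUB_pair_iff.1 hr).2
      have hmin := (Odot.minBelow_eq_union_iff.1 hm).2
      obtain ⟨z, hz, -⟩ := WithBot.coe_le_iff.1 (hlub.1 (Set.mem_insert _ _))
      rw [hz] at hlub hmin
      exact ⟨z, isLUB_pair_coe_iff.1 hlub, by simpa [Odot.inr] using hmin⟩
  · rintro ⟨hX, hY⟩ p q
    obtain ⟨a, ha, hma⟩ := hX.exists_isLUB_withBot p.1.1 q.1.1
    obtain ⟨b, hb, hmb⟩ := hY.exists_isLUB_withBot p.1.2 q.1.2
    have hab : (a, b) ≠ (⊥, ⊥) := fun h => p.2 <| le_bot_iff.1 <|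
      (Prod.le_def.2 ⟨ha.1 (Set.mem_insert _ _), hb.1 (Set.mem_insert _ _)⟩).trans_eq h
    exact ⟨⟨(a, b), hab⟩, Odot.isLUB_pair_iff.2 ⟨ha, hb⟩,
      Odot.minBelow_eq_union_iff.2 ⟨hma, hmb⟩⟩
end

section
/- Let X be a finite poset in P^f_1. If there exist a, b, c, d, x ∈ X such that (i) a ≤ c, a ≤ d, b ≤ c, b ≤ d, c ≤ x and d ≤ x, and (ii) there is no e ∈ X with a ≤ e, b ≤ e, e ≤ c and e ≤ d, then the preordered class Un_1(X) of 1-unifiers for X admits no minimal complete set (type 0). -/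
/-! ### Minimal elements in posets of `P^f_1` -/

theorem minBelow_nonempty {X : Type*} [PartialOrder X] [Finite X] (x : X) :
    (minBelow X x).Nonempty := by
  obtain ⟨m, hmx, hm⟩ := (Set.toFinite (Set.univ : Set X)).exists_le_minimal (Set.mem_univ x)
  exact ⟨m, hmx, fun z hz => le_antisymm hz (hm.2 (Set.mem_univ z) hz)⟩

theorem minBelow_eq_singleton {X : Type*} [PartialOrder X] [Finite X] (hX : InPfn 1 X) {x m : X}
    (hm : m ∈ minBelow X x) : minBelow X x = {m} :=
  ((Set.ncard_le_one_iff_eq (Set.toFinite _)).1 (hX x)).elim (fun h => by simp [h] at hm) <| by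
    rintro ⟨k, hk⟩
    rw [hk] at hm ⊢
    rw [Set.mem_singleton_iff.1 hm]

theorem minBelow_mono {X : Type*} [PartialOrder X] {x y : X} (h : x ≤ y) :
    minBelow X x ⊆ minBelow X y :=
  fun _ hm => ⟨hm.1.trans h, hm.2⟩

theorem minBelow_eq_bot {L : Type*} [PartialOrder L] [OrderBot L] (p : L) :
    minBelow L p = {⊥} := by
  ext m
  refine ⟨fun hm => (hm.2 ⊥ bot_le).symm, ?_⟩
  rintro rfl
  exact ⟨bot_le, fun z hz => le_bot_iff.1 hz⟩

theorem inPfn_one_of_orderBot (L : Type*) [PartialOrder L] [OrderBot L] : InPfn 1 L := fun p => by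
  rw [minBelow_eq_bot, Set.ncard_singleton]

theorem starCondN_of_lattice (n : ℕ) (L : Type*) [Lattice L] [OrderBot L] : StarCondN n L :=
  fun p q _ => ⟨p ⊔ q, isLUB_pair, by simp [minBelow_eq_bot]⟩

/-! ### Disjoint unions -/

theorem minBelow_inl {P Q : Type*} [PartialOrder P] [PartialOrder Q] (p : P) :
    minBelow (P ⊕ Q) (.inl p) = Sum.inl '' minBelow P p := by
  ext (m | m) <;> simp [minBelow]

theorem minBelow_inr {P Q : Type*} [PartialOrder P] [PartialOrder Q] (q : Q) :
    minBelow (P ⊕ Q) (.inr q) = Sum.inr '' minBelow Q q := by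
  ext (m | m) <;> simp [minBelow]

theorem isLUB_pair_inl {P Q : Type*} [PartialOrder P] [PartialOrder Q] {x y z : P}
    (h : IsLUB {x, y} z) : IsLUB {(.inl x : P ⊕ Q), .inl y} (.inl z) := by
  simp only [IsLUB, IsLeast, mem_upperBounds, mem_lowerBounds] at h ⊢
  simpa using h

theorem isLUB_pair_inr {P Q : Type*} [PartialOrder P] [PartialOrder Q] {x y z : Q}
    (h : IsLUB {x, y} z) : IsLUB {(.inr x : P ⊕ Q), .inr y} (.inr z) := by
  simp only [IsLUB, IsLeast, mem_upperBounds, mem_lowerBounds] at h ⊢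
  simpa using h

theorem InPfn.sum {n : ℕ} {P Q : Type*} [PartialOrder P] [PartialOrder Q]
    (hP : InPfn n P) (hQ : InPfn n Q) : InPfn n (P ⊕ Q) := by
  rintro (p | q)
  · rw [minBelow_inl, Set.ncard_image_of_injective _ Sum.inl_injective]
    exact hP p
  · rw [minBelow_inr, Set.ncard_image_of_injective _ Sum.inr_injective]
    exact hQ q

theorem StarCondN.sum {P Q : Type*} [PartialOrder P] [PartialOrder Q] [Finite P] [Finite Q]
    (hP : StarCondN 1 P) (hQ : StarCondN 1 Q) : StarCondN 1 (P ⊕ Q) := by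
  have mixed (p : P) (q : Q) :
      ¬ (Sum.inl '' minBelow P p ∪ Sum.inr '' minBelow Q q : Set (P ⊕ Q)).ncard ≤ 1 := fun h => by
    obtain ⟨m, hm⟩ := minBelow_nonempty p
    obtain ⟨k, hk⟩ := minBelow_nonempty q
    exact Sum.inl_ne_inr ((Set.ncard_le_one (Set.toFinite _)).1 h _ (.inl ⟨m, hm, rfl⟩) _ (.inr ⟨k, hk, rfl⟩))
  rintro (x | x) (y | y) h
  · rw [minBelow_inl, minBelow_inl, ← Set.image_union,
      Set.ncard_image_of_injective _ Sum.inl_injective] at h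
    obtain ⟨z, hz, hmin⟩ := hP x y h
    exact ⟨.inl z, isLUB_pair_inl hz, by simp only [minBelow_inl, hmin, Set.image_union]⟩
  · rw [minBelow_inl, minBelow_inr] at h
    exact absurd h (mixed x y)
  · rw [minBelow_inl, minBelow_inr, Set.union_comm] at h
    exact absurd h (mixed y x)
  · rw [minBelow_inr, minBelow_inr, ← Set.image_union,
      Set.ncard_image_of_injective _ Sum.inr_injective] at h
    obtain ⟨z, hz, hmin⟩ := hQ x y h
    exact ⟨.inr z, isLUB_pair_inr hz, by simp only [minBelow_inr, hmin, Set.image_union]⟩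

theorem IsPMorphism.sumElim {P Q X : Type*} [PartialOrder P] [PartialOrder Q] [PartialOrder X]
    {u : P → X} {v : Q → X} (hu : IsPMorphism u) (hv : IsPMorphism v) :
    IsPMorphism (Sum.elim u v) := by
  constructor
  · rintro (x | x) (y | y) h
    · exact hu.1 (Sum.inl_le_inl_iff.1 h)
    · exact absurd h Sum.not_inl_le_inr
    · exact absurd h Sum.not_inr_le_inl
    · exact hv.1 (Sum.inr_le_inr_iff.1 h)
  · rintro (x | x)
    · simpa [minBelow_inl, Set.image_image] using hu.2 x
    · simpa [minBelow_inr, Set.image_image] using hv.2 x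

theorem IsPMorphism.comp {P Q R : Type*} [PartialOrder P] [PartialOrder Q] [PartialOrder R]
    {v : Q → R} {u : P → Q} (hv : IsPMorphism v) (hu : IsPMorphism u) : IsPMorphism (v ∘ u) :=
  ⟨hv.1.comp hu.1, fun p => by rw [Set.image_comp, hu.2, hv.2, Function.comp_apply]⟩

theorem isPMorphism_inl {P Q : Type*} [PartialOrder P] [PartialOrder Q] :
    IsPMorphism (Sum.inl : P → P ⊕ Q) :=
  ⟨Sum.inl_mono, fun p => (minBelow_inl p).symm⟩

theorem isPMorphism_inr {P Q : Type*} [PartialOrder P] [PartialOrder Q] :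
    IsPMorphism (Sum.inr : Q → P ⊕ Q) :=
  ⟨Sum.inr_mono, fun q => (minBelow_inr q).symm⟩

theorem UnifierNLE.trans {n : ℕ} {X : Type} [PartialOrder X] [Finite X] {u v w : UnifierN n X}
    (huv : UnifierNLE u v) (hvw : UnifierNLE v w) : UnifierNLE u w := by
  obtain ⟨φ, hφ, hφ'⟩ := huv
  obtain ⟨ψ, hψ, hψ'⟩ := hvw
  exact ⟨ψ ∘ φ, hψ.comp hφ, by rw [← Function.comp_assoc, hψ', hφ']⟩

/-- The disjoint union of two `1`-unifiers. -/
def UnifierN.sum {X : Type} [PartialOrder X] [Finite X] (v w : UnifierN 1 X) : UnifierN 1 X where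
  Y := v.Y ⊕ w.Y
  ne := v.ne.map Sum.inl
  mem := v.mem.sum w.mem
  star := v.star.sum w.star
  u := Sum.elim v.u w.u
  hu := v.hu.sumElim w.hu

theorem UnifierN.le_sum_left {X : Type} [PartialOrder X] [Finite X] (v w : UnifierN 1 X) :
    UnifierNLE v (v.sum w) :=
  ⟨Sum.inl, isPMorphism_inl, rfl⟩

theorem UnifierN.le_sum_right {X : Type} [PartialOrder X] [Finite X] (v w : UnifierN 1 X) :
    UnifierNLE w (v.sum w) :=
  ⟨Sum.inr, isPMorphism_inr, rfl⟩

/-- If no `1`-unifier is above all others, there is no minimal complete set. -/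
theorem not_exists_isMinimalCompleteSet_of_forall_exists_not_le {X : Type} [PartialOrder X]
    [Finite X] [Nonempty (UnifierN 1 X)]
    (h : ∀ v : UnifierN 1 X, ∃ w : UnifierN 1 X, ¬ UnifierNLE w v) :
    ¬ ∃ M : Set (UnifierN 1 X), IsMinimalCompleteSet UnifierNLE M := by
  rintro ⟨M, hM, hmin⟩
  obtain ⟨v, hv, -⟩ := hM (Classical.arbitrary _)
  obtain ⟨w, hw⟩ := h v
  obtain ⟨v', hv', hle⟩ := hM (v.sum w)
  obtain rfl := hmin v hv v' hv' ((v.le_sum_left w).trans hle)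
  exact hw ((v.le_sum_right w).trans hle)

/-! ### Concept lattices without monochromatic quotients -/

/-- A relation between two copies of `ι` (objects `aᵢ` and `bᵢ`) and two further copies
(attributes `cᵢ` and `dᵢ`): `aᵢ`, `bⱼ` are never both related to both of `cₖ`, `dₗ`. -/
def twistRel (ι : Type*) [LT ι] : ι ⊕ ι → ι ⊕ ι → Prop
  | .inl i, .inl j => i < j
  | .inl i, .inr j => j < i
  | .inr i, .inl j => j < i
  | .inr i, .inr j => i < j

/-- The lattice of concepts of `twistRel`. -/
abbrev TwistLattice (ι : Type*) [LT ι] : Type _ :=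
  Concept (ι ⊕ ι) (ι ⊕ ι) (twistRel ι)

namespace TwistLattice

variable {ι : Type*} [LinearOrder ι]

instance [Finite ι] : Finite (TwistLattice ι) :=
  Finite.of_injective _ Concept.extent_injective

theorem extent_bot : (⊥ : TwistLattice ι).extent = ∅ := by
  refine Set.eq_empty_of_forall_notMem ?_
  rintro (i | i) hi
  · exact lt_irrefl i ((mem_lowerPolar_iff.1 hi) (Set.mem_univ (Sum.inl i)))
  · exact lt_irrefl i ((mem_lowerPolar_iff.1 hi) (Set.mem_univ (Sum.inl i)))

theorem not_rainbow (p : TwistLattice ι) {i j k l : ι} (hi : .inl i ∈ p.extent)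
    (hj : .inr j ∈ p.extent) (hk : .inl k ∈ p.intent) (hl : .inr l ∈ p.intent) : False := by
  have hik : i < k := p.rel_extent_intent hi hk
  have hkj : k < j := p.rel_extent_intent hj hk
  have hjl : j < l := p.rel_extent_intent hj hl
  have hli : l < i := p.rel_extent_intent hi hl
  exact lt_irrefl i (hik.trans (hkj.trans (hjl.trans hli)))

variable {X : Type*} (r a b c d x : X)

open Classical in
/-- The colouring of a concept by `r, a, b, c, d, x`, according to the types of the objects in
its extent and of the attributes in its intent. -/
noncomputable def color (p : TwistLattice ι) : X :=
  if ∃ i, .inl i ∈ p.extent then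
    if ∃ i, .inr i ∈ p.extent then
      if ∃ i, .inl i ∈ p.intent then c else if ∃ i, .inr i ∈ p.intent then d else x
    else a
  else if ∃ i, .inr i ∈ p.extent then b else r

variable {r a b c d x}

theorem color_bot : color r a b c d x (⊥ : TwistLattice ι) = r := by
  rw [color, if_neg, if_neg] <;> rintro ⟨i, hi⟩ <;> rw [extent_bot] at hi <;> exact hi

variable [PartialOrder X]

theorem color_mono (hra : r ≤ a) (hrb : r ≤ b)
    (h1 : a ≤ c ∧ a ≤ d ∧ b ≤ c ∧ b ≤ d ∧ c ≤ x ∧ d ≤ x) :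
    Monotone (color r a b c d x : TwistLattice ι → X) := by
  obtain ⟨hac, had, hbc, hbd, hcx, hdx⟩ := h1
  have hax := hac.trans hcx
  have hbx := hbc.trans hcx
  intro p q hpq
  have hA : (∃ i, .inl i ∈ p.extent) → ∃ i, .inl i ∈ q.extent := fun ⟨i, hi⟩ => ⟨i, hpq hi⟩
  have hB : (∃ i, .inr i ∈ p.extent) → ∃ i, .inr i ∈ q.extent := fun ⟨i, hi⟩ => ⟨i, hpq hi⟩
  have hpq' := Concept.intent_subset_intent_iff.2 hpq
  have hC : (∃ i, .inl i ∈ q.intent) → ∃ i, .inl i ∈ p.intent := fun ⟨i, hi⟩ => ⟨i, hpq' hi⟩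
  have hD : (∃ i, .inr i ∈ q.intent) → ∃ i, .inr i ∈ p.intent := fun ⟨i, hi⟩ => ⟨i, hpq' hi⟩
  have hR : (∃ i, .inl i ∈ p.extent) → (∃ i, .inr i ∈ p.extent) → (∃ i, .inl i ∈ p.intent) →
      (∃ i, .inr i ∈ p.intent) → False :=
    fun ⟨_, hi⟩ ⟨_, hj⟩ ⟨_, hk⟩ ⟨_, hl⟩ => p.not_rainbow hi hj hk hl
  unfold color
  generalize (∃ i, .inl i ∈ p.extent) = A at *
  generalize (∃ i, .inr i ∈ p.extent) = B at *
  generalize (∃ i, .inl i ∈ p.intent) = C at *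
  generalize (∃ i, .inr i ∈ p.intent) = D at *
  generalize (∃ i, .inl i ∈ q.extent) = A' at *
  generalize (∃ i, .inr i ∈ q.extent) = B' at *
  generalize (∃ i, .inl i ∈ q.intent) = C' at *
  generalize (∃ i, .inr i ∈ q.intent) = D' at *
  clear hpq hpq'
  grind

theorem le_color_inl (h1 : a ≤ c ∧ a ≤ d ∧ b ≤ c ∧ b ≤ d ∧ c ≤ x ∧ d ≤ x)
    (p : TwistLattice ι) {i : ι} (hi : .inl i ∈ p.extent) :
    a ≤ color r a b c d x p := by
  have := h1.1.trans h1.2.2.2.2.1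
  have hA : ∃ i, .inl i ∈ p.extent := ⟨i, hi⟩
  unfold color
  split_ifs <;> first | exact le_rfl | tauto

theorem le_color_inr (h1 : a ≤ c ∧ a ≤ d ∧ b ≤ c ∧ b ≤ d ∧ c ≤ x ∧ d ≤ x)
    (p : TwistLattice ι) {i : ι} (hi : .inr i ∈ p.extent) :
    b ≤ color r a b c d x p := by
  have := h1.2.2.1.trans h1.2.2.2.2.1
  have hB : ∃ i, .inr i ∈ p.extent := ⟨i, hi⟩
  unfold color
  split_ifs <;> first | exact le_rfl | tauto

theorem color_le_inl (h1 : a ≤ c ∧ a ≤ d ∧ b ≤ c ∧ b ≤ d ∧ c ≤ x ∧ d ≤ x)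
    (hra : r ≤ a) (p : TwistLattice ι) {i : ι} (hi : .inl i ∈ p.intent) :
    color r a b c d x p ≤ c := by
  have := hra.trans h1.1
  have hC : ∃ i, .inl i ∈ p.intent := ⟨i, hi⟩
  unfold color
  split_ifs <;> first | exact le_rfl | tauto

theorem color_le_inr (h1 : a ≤ c ∧ a ≤ d ∧ b ≤ c ∧ b ≤ d ∧ c ≤ x ∧ d ≤ x)
    (hra : r ≤ a) (p : TwistLattice ι) {i : ι} (hi : .inr i ∈ p.intent) :
    color r a b c d x p ≤ d := by
  have := hra.trans h1.2.1
  have hR : (∃ i, .inl i ∈ p.extent) → (∃ i, .inr i ∈ p.extent) → (∃ i, .inl i ∈ p.intent) →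
      False := fun ⟨_, hi'⟩ ⟨_, hj⟩ ⟨_, hk⟩ => p.not_rainbow hi' hj hk hi
  have hD : ∃ i, .inr i ∈ p.intent := ⟨i, hi⟩
  unfold color
  split_ifs <;> first | exact le_rfl | tauto

theorem isPMorphism_color [Finite X] (h1 : a ≤ c ∧ a ≤ d ∧ b ≤ c ∧ b ≤ d ∧ c ≤ x ∧ d ≤ x)
    (hX : InPfn 1 X) (hra : r ≤ a) (hrb : r ≤ b)
    (hr : ∀ z, z ≤ r → z = r) : IsPMorphism (color r a b c d x : TwistLattice ι → X) := by
  have hmono := color_mono (ι := ι) hra hrb h1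
  refine ⟨hmono, fun p => ?_⟩
  have hrp : r ≤ color r a b c d x p := color_bot.symm.le.trans (hmono bot_le)
  rw [minBelow_eq_bot, Set.image_singleton, color_bot, minBelow_eq_singleton hX ⟨hrp, hr⟩]

end TwistLattice

/-- The colouring of `TwistLattice` as a `1`-unifier. -/
noncomputable def twistUnifier (ι : Type) [LinearOrder ι] [Finite ι] {X : Type} [PartialOrder X]
    [Finite X] (hX : InPfn 1 X) {r a b c d x : X}
    (h1 : a ≤ c ∧ a ≤ d ∧ b ≤ c ∧ b ≤ d ∧ c ≤ x ∧ d ≤ x) (hra : r ≤ a) (hrb : r ≤ b)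
    (hr : ∀ z, z ≤ r → z = r) : UnifierN 1 X where
  Y := TwistLattice ι
  ne := ⟨⊥⟩
  mem := inPfn_one_of_orderBot _
  star := starCondN_of_lattice _ _
  u := TwistLattice.color r a b c d x
  hu := TwistLattice.isPMorphism_color h1 hX hra hrb hr

open Concept in
theorem not_twistUnifier_le {ι : Type} [LinearOrder ι] [Finite ι] {X : Type} [PartialOrder X]
    [Finite X] (hX : InPfn 1 X) {r a b c d x : X}
    (h1 : a ≤ c ∧ a ≤ d ∧ b ≤ c ∧ b ≤ d ∧ c ≤ x ∧ d ≤ x) (hra : r ≤ a) (hrb : r ≤ b)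
    (hr : ∀ z, z ≤ r → z = r) (h2 : ¬ ∃ e : X, a ≤ e ∧ b ≤ e ∧ e ≤ c ∧ e ≤ d) (v : UnifierN 1 X)
    (hv : Nat.card (v.Y × v.Y × v.Y × v.Y) < Nat.card ι) :
    ¬ UnifierNLE (twistUnifier ι hX h1 hra hrb hr) v := by
  rintro ⟨ψ, hψ, hcomp⟩
  change TwistLattice ι → v.Y at ψ
  have hψm : Monotone ψ := hψ.1
  have hcol (p : TwistLattice ι) : v.u (ψ p) = TwistLattice.color r a b c d x p :=
    congrFun hcomp p
  have hmin (p : TwistLattice ι) : minBelow v.Y (ψ p) = {ψ ⊥} := by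
    rw [← Set.image_singleton, ← minBelow_eq_bot p]
    exact (hψ.2 p).symm
  let A (i : ι) : TwistLattice ι := ofObject (twistRel ι) (.inl i)
  let B (i : ι) : TwistLattice ι := ofObject (twistRel ι) (.inr i)
  let C (i : ι) : TwistLattice ι := ofAttribute (twistRel ι) (.inl i)
  let D (i : ι) : TwistLattice ι := ofAttribute (twistRel ι) (.inr i)
  obtain ⟨i, j, hlt, heq⟩ : ∃ i j, i < j ∧
      (ψ (A i), ψ (B i), ψ (C i), ψ (D i)) = (ψ (A j), ψ (B j), ψ (C j), ψ (D j)) := by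
    by_contra! hne
    refine hv.not_ge (Nat.card_le_card_of_injective
      (fun i => (ψ (A i), ψ (B i), ψ (C i), ψ (D i))) fun i j hij => ?_)
    by_contra hij'
    rcases lt_or_gt_of_ne hij' with h | h
    · exact hne i j h hij
    · exact hne j i h hij.symm
  simp only [Prod.mk.injEq] at heq
  obtain ⟨hA, hB, hC, hD⟩ := heq
  have hAC : ψ (A i) ≤ ψ (C i) := hC ▸ hψm (ofObject_le_ofAttribute_iff.2 hlt)
  have hAD : ψ (A i) ≤ ψ (D i) := hA ▸ hψm (ofObject_le_ofAttribute_iff.2 hlt)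
  have hBC : ψ (B i) ≤ ψ (C i) := hB ▸ hψm (ofObject_le_ofAttribute_iff.2 hlt)
  have hBD : ψ (B i) ≤ ψ (D i) := hD ▸ hψm (ofObject_le_ofAttribute_iff.2 hlt)
  obtain ⟨z, hz, -⟩ := v.star (ψ (A i)) (ψ (B i)) (by simp [hmin])
  have hAz : ψ (A i) ≤ z := hz.1 (by simp)
  have hBz : ψ (B i) ≤ z := hz.1 (by simp)
  have hzC : z ≤ ψ (C i) := hz.2 (by simp [hAC, hBC])
  have hzD : z ≤ ψ (D i) := hz.2 (by simp [hAD, hBD])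
  refine h2 ⟨v.u z, ?_, ?_, ?_, ?_⟩
  · refine le_trans ?_ (v.hu.1 hAz)
    rw [hcol]
    exact TwistLattice.le_color_inl h1 _ (ofObjects_le_iff.1 le_rfl rfl)
  · refine le_trans ?_ (v.hu.1 hBz)
    rw [hcol]
    exact TwistLattice.le_color_inr h1 _ (ofObjects_le_iff.1 le_rfl rfl)
  · refine (v.hu.1 hzC).trans ?_
    rw [hcol]
    exact TwistLattice.color_le_inl h1 hra _ (le_ofAttributes_iff.1 le_rfl rfl)
  · refine (v.hu.1 hzD).trans ?_
    rw [hcol]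
    exact TwistLattice.color_le_inr h1 hra _ (le_ofAttributes_iff.1 le_rfl rfl)

/-- Lemma: a poset in `P^f_1` containing the configuration `a, b ≤ c, d ≤ x` with no
element between `{a, b}` and `{c, d}` has unification type 0 in `P^f_1`. -/
theorem pfOne_config_no_minimal_complete_set (X : Type) [PartialOrder X] [Finite X]
    (hX : InPfn 1 X) (a b c d x : X)
    (h1 : a ≤ c ∧ a ≤ d ∧ b ≤ c ∧ b ≤ d ∧ c ≤ x ∧ d ≤ x)
    (h2 : ¬ ∃ e : X, a ≤ e ∧ b ≤ e ∧ e ≤ c ∧ e ≤ d) :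
    ¬ ∃ M : Set (UnifierN 1 X), IsMinimalCompleteSet UnifierNLE M := by
  obtain ⟨r, hra, hr⟩ := minBelow_nonempty a
  have hrb : r ≤ b := by
    obtain ⟨s, hsb, hs⟩ := minBelow_nonempty b
    have hrc : r ∈ minBelow X c := minBelow_mono h1.1 ⟨hra, hr⟩
    have hsc : s ∈ minBelow X c := minBelow_mono h1.2.2.1 ⟨hsb, hs⟩
    rw [minBelow_eq_singleton hX hrc, Set.mem_singleton_iff] at hsc
    exact hsc ▸ hsb
  have : Nonempty (UnifierN 1 X) := ⟨twistUnifier (Fin 0) hX h1 hra hrb hr⟩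
  refine not_exists_isMinimalCompleteSet_of_forall_exists_not_le fun v => ?_
  exact ⟨twistUnifier (Fin (Nat.card (v.Y × v.Y × v.Y × v.Y) + 1)) hX h1 hra hrb hr,
    not_twistUnifier_le hX h1 hra hrb hr h2 v (by simp only [Nat.card_fin, Nat.lt_succ_self])⟩
end

section
/- Let X and Y be finite posets and let u : X → Y be a p-morphism. If X satisfies condition (*), then the image u(X) is a connected subset of Y. -/
/-- The image of a p-morphism whose domain satisfies `(*)` is a connected subset. -/
theorem range_of_pMorphism_connected (X Y : Type*) [PartialOrder X] [PartialOrder Y]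
    [Finite X] [Finite Y] (u : X → Y) (hu : IsPMorphism u) (hX : StarCond X) :
    IsConnectedSub Y (Set.range u) := by
  obtain ⟨hmono, hmin⟩ := hu
  refine ⟨?_, ?_⟩
  · rintro _ ⟨x, rfl⟩
    rw [← hmin x]
    exact Set.image_subset_range _ _
  · rintro _ ⟨x, rfl⟩ _ ⟨y, rfl⟩
    obtain ⟨z, hz, hzmin⟩ := hX x y
    refine ⟨u z, ⟨z, rfl⟩, hmono (hz.1 (by simp)), hmono (hz.1 (by simp)), ?_⟩
    rw [← hmin, ← hmin, ← hmin, hzmin, Set.image_union]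
end
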